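/- Let U ⊆ ℂ^m be open, let h be a hermitian metric on the trivial bundle U×ℂ^N with Chern connection D_j and curvature Θ_{jk}, and let t₀ ∈ U. Then the following are equivalent: (i) Σ_{j,k=1}^m ⟪h(t₀)·Θ_{jk}(t₀)·a_j, a_k⟫ ≥ 0 for all a₁,…,a_m ∈ ℂ^N (Nakano semipositivity of the curvature at t₀); (ii) for every m-tuple of holomorphic maps u₁,…,u_m : U → ℂ^N satisfying (D_j u_k)(t₀) = 0 for all 1 ≤ j,k ≤ m, the number Σ_{j,k=1}^m ∂_{t_j}∂̄_{t_k}[ t ↦ ⟪h(t)·u_j(t), u_k(t)⟫ ] evaluated at t = t₀ is real and ≤ 0. (The criterion (2.5) for Nakano positivity via the form T_u, Section 2.) -/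

import Mathlib

open Complex Matrix
open scoped ComplexOrder

noncomputable section

/-- The Wirtinger derivative `∂_w f (x)` in the direction `w`,
defined via the real Fréchet derivative. -/
def wD {E : Type*} [NormedAddCommGroup E] [NormedSpace ℂ E] (f : E → ℂ) (x w : E) : ℂ :=
  (fderiv ℝ f x w - Complex.I * fderiv ℝ f x (Complex.I • w)) / 2

/-- The Wirtinger derivative `∂̄_w f (x)` in the direction `w`. -/
def wDbar {E : Type*} [NormedAddCommGroup E] [NormedSpace ℂ E] (f : E → ℂ) (x w : E) : ℂ :=
  (fderiv ℝ f x w + Complex.I * fderiv ℝ f x (Complex.I • w)) / 2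

/-- The standard inner product `⟪x,y⟫ = Σ_i x_i·conj(y_i)` on `ℂ^N`. -/
def sip {N : ℕ} (x y : Fin N → ℂ) : ℂ := ∑ i, x i * (starRingEnd ℂ) (y i)

/-- Entrywise Wirtinger `∂_j` of a matrix-valued function. -/
def mD {m N : ℕ} (f : (Fin m → ℂ) → Matrix (Fin N) (Fin N) ℂ) (x : Fin m → ℂ) (j : Fin m) :
    Matrix (Fin N) (Fin N) ℂ :=
  Matrix.of fun a b => wD (fun s => f s a b) x (Pi.single j 1)

/-- Entrywise Wirtinger `∂̄_k` of a matrix-valued function. -/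
def mDbar {m N : ℕ} (f : (Fin m → ℂ) → Matrix (Fin N) (Fin N) ℂ) (x : Fin m → ℂ) (k : Fin m) :
    Matrix (Fin N) (Fin N) ℂ :=
  Matrix.of fun a b => wDbar (fun s => f s a b) x (Pi.single k 1)

/-- Entrywise Wirtinger `∂_j` of a vector-valued function. -/
def vD {m N : ℕ} (f : (Fin m → ℂ) → (Fin N → ℂ)) (x : Fin m → ℂ) (j : Fin m) : Fin N → ℂ :=
  fun a => wD (fun s => f s a) x (Pi.single j 1)

/-- Entrywise Wirtinger `∂̄_k` of a vector-valued function. -/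
def vDbar {m N : ℕ} (f : (Fin m → ℂ) → (Fin N → ℂ)) (x : Fin m → ℂ) (k : Fin m) : Fin N → ℂ :=
  fun a => wDbar (fun s => f s a) x (Pi.single k 1)

/-- The Chern connection `D_j u = ∂_j u + h⁻¹(∂_j h)·u` of the hermitian metric `h`. -/
def chern {m N : ℕ} (h : (Fin m → ℂ) → Matrix (Fin N) (Fin N) ℂ)
    (u : (Fin m → ℂ) → (Fin N → ℂ)) (j : Fin m) (t : Fin m → ℂ) : Fin N → ℂ :=
  vD u t j + ((h t)⁻¹ * mD h t j) *ᵥ u t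

/-- The curvature `Θ_{jk} = −∂̄_k(h⁻¹·∂_j h)` of the hermitian metric `h`. -/
def curv {m N : ℕ} (h : (Fin m → ℂ) → Matrix (Fin N) (Fin N) ℂ)
    (j k : Fin m) (t : Fin m → ℂ) : Matrix (Fin N) (Fin N) ℂ :=
  - mDbar (fun s => (h s)⁻¹ * mD h s j) t k

open Metric Real in
/-- Directional derivatives of a function holomorphic on an open subset of `ℂ^m` are holomorphic. -/
theorem differentiableAt_fderiv_apply_of_differentiableOn {m : ℕ} {U : Set (Fin m → ℂ)}
    (hU : IsOpen U) {f : (Fin m → ℂ) → ℂ} (hf : DifferentiableOn ℂ f U) {x : Fin m → ℂ}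
    (hx : x ∈ U) (w : Fin m → ℂ) : DifferentiableAt ℂ (fun t => fderiv ℂ f t w) x := by
  have hfx : ContinuousAt f x := (hf.differentiableAt (hU.mem_nhds hx)).continuousAt
  obtain ⟨R, hR, hRball⟩ : ∃ R > 0, ∀ y ∈ ball x R, y ∈ U ∧ dist (f y) (f x) < 1 :=
    eventually_nhds_iff_ball.mp
      ((hU.eventually_mem hx).and (hfx.eventually (ball_mem_nhds _ one_pos)))
  obtain ⟨r, hr, hrR⟩ : ∃ r > 0, R = 4 * r := ⟨R / 4, by positivity, by ring⟩
  have hdiff : ∀ y ∈ ball x R, DifferentiableAt ℂ f y := fun y hy =>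
    hf.differentiableAt (hU.mem_nhds (hRball y hy).1)
  have hbound : ∀ y ∈ ball x (2 * r), ‖fderiv ℂ f y‖₊ ≤ Real.toNNReal (2 / r) := by
    intro y hy
    have hsub : ∀ z ∈ ball y r, z ∈ ball x R := by
      intro z hz
      simp only [mem_ball] at *
      linarith [dist_triangle z y x]
    rw [← NNReal.coe_le_coe, coe_nnnorm, Real.coe_toNNReal _ (by positivity)]
    refine norm_fderiv_le_div_of_mapsTo_ball
      (fun z hz => (hdiff z (hsub z hz)).differentiableWithinAt) ?_ hr
    intro z hz
    have h1 := (hRball z (hsub z hz)).2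
    have h2 := (hRball y (hsub y (mem_ball_self hr))).2
    rw [mem_closedBall]
    linarith [dist_triangle_right (f z) (f y) (f x)]
  have hlip : LipschitzOnWith (Real.toNNReal (2 / r)) f (ball x (2 * r)) :=
    (convex_ball x (2 * r)).lipschitzOnWith_of_nnnorm_fderiv_le
      (fun y hy => hdiff y (ball_subset_ball (by linarith) hy)) hbound
  obtain ⟨ρ, hρ, hρw⟩ : ∃ ρ > 0, ρ * ‖w‖ < r := by
    refine ⟨r / (‖w‖ + 1), by positivity, ?_⟩
    rw [div_mul_eq_mul_div, div_lt_iff₀ (by positivity)]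
    nlinarith
  have hshift : ∀ t ∈ ball x r, ∀ ζ ∈ closedBall (0 : ℂ) ρ, t + ζ • w ∈ ball x (2 * r) := by
    intro t ht ζ hζ
    rw [mem_closedBall, dist_zero_right] at hζ
    have h1 : ‖ζ • w‖ ≤ ρ * ‖w‖ := by rw [norm_smul]; gcongr
    rw [mem_ball, dist_eq_norm] at *
    calc ‖t + ζ • w - x‖ = ‖(t - x) + ζ • w‖ := by congr 1; abel
      _ ≤ ‖t - x‖ + ‖ζ • w‖ := norm_add_le _ _
      _ < 2 * r := by linarith
  have hcircle : ∀ θ, circleMap 0 ρ θ ∈ closedBall (0 : ℂ) ρ := fun θ =>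
    circleMap_mem_closedBall 0 hρ.le θ
  set c : ℝ → ℂ := fun θ => deriv (circleMap 0 ρ) θ * ((circleMap 0 ρ θ) ^ 2)⁻¹ with hc
  have hc_norm : ∀ θ, ‖c θ‖ = ρ⁻¹ := by
    intro θ
    simp [hc, abs_of_pos hρ]
    field_simp
  have hc_cont : Continuous c := by
    simp only [hc, deriv_circleMap]
    exact ((continuous_circleMap 0 ρ).mul continuous_const).mul
      (((continuous_circleMap 0 ρ).pow 2).inv₀
        fun θ => pow_ne_zero _ (circleMap_ne_center hρ.ne'))
  have hF_cont : ∀ t ∈ ball x r, Continuous fun θ => c θ * f (t + circleMap 0 ρ θ • w) := by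
    intro t ht
    refine hc_cont.mul (hlip.continuousOn.comp_continuous (by fun_prop) fun θ => ?_)
    exact hshift t ht _ (hcircle θ)
  have hCauchy : ∀ t ∈ ball x r, fderiv ℂ f t w =
      (2 * π * I : ℂ)⁻¹ * ∫ θ in (0 : ℝ)..2 * π, c θ * f (t + circleMap 0 ρ θ • w) := by
    intro t ht
    have hopen : IsOpen {ζ : ℂ | t + ζ • w ∈ ball x R} :=
      isOpen_ball.preimage (f := fun ζ : ℂ => t + ζ • w) (by fun_prop)
    have hline : ∀ ζ : ℂ, HasDerivAt (fun ζ : ℂ => t + ζ • w) w ζ := fun ζ => by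
      simpa using ((hasDerivAt_id ζ).smul_const w).const_add t
    have key := two_pi_I_inv_smul_circleIntegral_sub_sq_inv_smul_of_differentiable hopen
      (c := 0) (w₀ := 0) (R := ρ) (f := fun ζ => f (t + ζ • w))
      (fun ζ hζ => ball_subset_ball (by linarith) (hshift t ht ζ hζ))
      (fun ζ hζ => ((hdiff _ hζ).comp ζ (hline ζ).differentiableAt).differentiableWithinAt)
      (mem_ball_self hρ)
    have hderiv : deriv (fun ζ : ℂ => f (t + ζ • w)) 0 = fderiv ℂ f t w := by
      have h0 : HasFDerivAt f (fderiv ℂ f t) (t + (0 : ℂ) • w) := by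
        rw [zero_smul, add_zero]
        exact (hdiff t (ball_subset_ball (by linarith) ht)).hasFDerivAt
      exact (h0.comp_hasDerivAt 0 (hline 0)).deriv
    rw [← hderiv, ← key, circleIntegral, smul_eq_mul]
    congr 1
    refine intervalIntegral.integral_congr fun θ _ => ?_
    simp [hc, mul_assoc]
  have hint := (intervalIntegral.hasFDerivAt_integral_of_dominated_loc_of_lip (𝕜 := ℂ)
    (μ := MeasureTheory.volume) (a := 0) (b := 2 * π)
    (F := fun t θ => c θ * f (t + circleMap 0 ρ θ • w))
    (F' := fun θ => c θ • fderiv ℂ f (x + circleMap 0 ρ θ • w))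
    (bound := fun _ => ρ⁻¹ * (2 / r)) (ball_mem_nhds x hr) ?_ ?_ ?_ ?_ ?_ ?_).2
  · refine (hint.differentiableAt.const_mul (2 * π * I : ℂ)⁻¹).congr_of_eventuallyEq ?_
    filter_upwards [ball_mem_nhds x hr] with t ht using hCauchy t ht
  · filter_upwards [ball_mem_nhds x hr] with t ht using (hF_cont t ht).aestronglyMeasurable
  · exact (hF_cont x (mem_ball_self hr)).intervalIntegrable _ _
  · refine hc_cont.aestronglyMeasurable.smul (Measurable.aestronglyMeasurable ?_)
    exact (measurable_fderiv ℂ f).comp (by fun_prop)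
  · refine Filter.Eventually.of_forall fun θ _ => LipschitzOnWith.of_dist_le_mul ?_
    intro y hy z hz
    have h1 := hlip.dist_le_mul _ (hshift y hy _ (hcircle θ)) _ (hshift z hz _ (hcircle θ))
    rw [dist_add_right, Real.coe_toNNReal _ (by positivity)] at h1
    rw [Real.coe_nnabs, abs_of_pos (by positivity), dist_eq_norm, ← mul_sub, norm_mul, hc_norm,
      mul_assoc, ← dist_eq_norm]
    gcongr
  · exact intervalIntegrable_const
  · refine Filter.Eventually.of_forall fun θ _ => ?_
    have h0 := (hdiff _ (ball_subset_ball (by linarith)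
      (hshift x (mem_ball_self hr) _ (hcircle θ)))).hasFDerivAt
    exact (h0.comp x ((hasFDerivAt_id x).add_const _)).const_mul (c θ)

section Wirtinger

variable {E : Type*} [NormedAddCommGroup E] [NormedSpace ℂ E] {f g : E → ℂ} {x : E}

theorem wD_congr (hfg : f =ᶠ[nhds x] g) (w : E) : wD f x w = wD g x w := by
  simp only [wD, hfg.fderiv_eq]

theorem wDbar_congr (hfg : f =ᶠ[nhds x] g) (w : E) : wDbar f x w = wDbar g x w := by
  simp only [wDbar, hfg.fderiv_eq]

theorem wD_mul (hf : DifferentiableAt ℝ f x) (hg : DifferentiableAt ℝ g x) (w : E) :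
    wD (fun t => f t * g t) x w = wD f x w * g x + f x * wD g x w := by
  simp only [wD, fderiv_fun_mul hf hg, _root_.add_apply,
    _root_.smul_apply, smul_eq_mul]
  ring

theorem wDbar_mul (hf : DifferentiableAt ℝ f x) (hg : DifferentiableAt ℝ g x) (w : E) :
    wDbar (fun t => f t * g t) x w = wDbar f x w * g x + f x * wDbar g x w := by
  simp only [wDbar, fderiv_fun_mul hf hg, _root_.add_apply,
    _root_.smul_apply, smul_eq_mul]
  ring

theorem wD_add (hf : DifferentiableAt ℝ f x) (hg : DifferentiableAt ℝ g x) (w : E) :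
    wD (fun t => f t + g t) x w = wD f x w + wD g x w := by
  simp only [wD, fderiv_fun_add hf hg, _root_.add_apply]
  ring

theorem wD_sum {ι : Type*} (s : Finset ι) {F : ι → E → ℂ}
    (hF : ∀ i ∈ s, DifferentiableAt ℝ (F i) x) (w : E) :
    wD (fun t => ∑ i ∈ s, F i t) x w = ∑ i ∈ s, wD (F i) x w := by
  simp only [wD, fderiv_fun_sum hF, _root_.sum_apply, Finset.mul_sum,
    ← Finset.sum_sub_distrib, Finset.sum_div]

theorem wDbar_sum {ι : Type*} (s : Finset ι) {F : ι → E → ℂ}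
    (hF : ∀ i ∈ s, DifferentiableAt ℝ (F i) x) (w : E) :
    wDbar (fun t => ∑ i ∈ s, F i t) x w = ∑ i ∈ s, wDbar (F i) x w := by
  simp only [wDbar, fderiv_fun_sum hF, _root_.sum_apply, Finset.mul_sum,
    ← Finset.sum_add_distrib, Finset.sum_div]

theorem differentiableAt_conj_comp (hf : DifferentiableAt ℝ f x) :
    DifferentiableAt ℝ (fun t => (starRingEnd ℂ) (f t)) x :=
  (Complex.conjCLE : ℂ →L[ℝ] ℂ).differentiableAt.comp x hf

theorem fderiv_conj_comp (hf : DifferentiableAt ℝ f x) (w : E) :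
    fderiv ℝ (fun t => (starRingEnd ℂ) (f t)) x w = (starRingEnd ℂ) (fderiv ℝ f x w) := by
  have h := ((Complex.conjCLE : ℂ →L[ℝ] ℂ).hasFDerivAt.comp x hf.hasFDerivAt).fderiv
  exact congrArg (fun L : E →L[ℝ] ℂ => L w) h

theorem wD_conj (hf : DifferentiableAt ℝ f x) (w : E) :
    wD (fun t => (starRingEnd ℂ) (f t)) x w = (starRingEnd ℂ) (wDbar f x w) := by
  simp only [wD, wDbar, fderiv_conj_comp hf]
  simp [sub_eq_add_neg, map_ofNat (starRingEnd ℂ) 2]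

theorem wDbar_conj (hf : DifferentiableAt ℝ f x) (w : E) :
    wDbar (fun t => (starRingEnd ℂ) (f t)) x w = (starRingEnd ℂ) (wD f x w) := by
  simp only [wD, wDbar, fderiv_conj_comp hf]
  simp [sub_eq_add_neg, map_ofNat (starRingEnd ℂ) 2]

theorem fderiv_real_eq_fderiv_complex (hf : DifferentiableAt ℂ f x) (w : E) :
    fderiv ℝ f x w = fderiv ℂ f x w := by
  rw [(hf.hasFDerivAt.restrictScalars ℝ).fderiv]
  rfl

theorem wD_eq_fderiv (hf : DifferentiableAt ℂ f x) (w : E) : wD f x w = fderiv ℂ f x w := by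
  simp only [wD, fderiv_real_eq_fderiv_complex hf, map_smul, smul_eq_mul, ← mul_assoc, I_mul_I]
  ring

theorem wDbar_eq_zero (hf : DifferentiableAt ℂ f x) (w : E) : wDbar f x w = 0 := by
  simp only [wDbar, fderiv_real_eq_fderiv_complex hf, map_smul, smul_eq_mul, ← mul_assoc, I_mul_I]
  ring

theorem differentiableAt_fderiv_apply (hf : ContDiffAt ℝ 2 f x) (w : E) :
    DifferentiableAt ℝ (fun t => fderiv ℝ f t w) x :=
  ((hf.fderiv_right (m := 1) (by norm_num)).differentiableAt one_ne_zero).clm_apply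
    (differentiableAt_const w)

theorem differentiableAt_wD (hf : ContDiffAt ℝ 2 f x) (w : E) :
    DifferentiableAt ℝ (fun t => wD f t w) x := by
  simp only [wD, div_eq_mul_inv]
  exact
    ((differentiableAt_fderiv_apply hf w).fun_sub
      ((differentiableAt_fderiv_apply hf (I • w)).const_mul I)).mul_const _

theorem differentiableAt_wDbar (hf : ContDiffAt ℝ 2 f x) (w : E) :
    DifferentiableAt ℝ (fun t => wDbar f t w) x := by
  simp only [wDbar, div_eq_mul_inv]
  exact
    ((differentiableAt_fderiv_apply hf w).fun_add
      ((differentiableAt_fderiv_apply hf (I • w)).const_mul I)).mul_const _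

theorem fderiv_fderiv_apply (hf : ContDiffAt ℝ 2 f x) (v w : E) :
    fderiv ℝ (fun t => fderiv ℝ f t w) x v = fderiv ℝ (fderiv ℝ f) x v w := by
  rw [fderiv_clm_apply ((hf.fderiv_right (m := 1) (by norm_num)).differentiableAt one_ne_zero)
    (differentiableAt_const w)]
  simp

theorem fderiv_wDbar (hf : ContDiffAt ℝ 2 f x) (v w : E) :
    fderiv ℝ (fun t => wDbar f t w) x v =
      (fderiv ℝ (fderiv ℝ f) x v w + I * fderiv ℝ (fderiv ℝ f) x v (I • w)) / 2 := by
  have h := (((differentiableAt_fderiv_apply hf w).hasFDerivAt.fun_add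
    ((differentiableAt_fderiv_apply hf (I • w)).hasFDerivAt.const_mul I)).mul_const (2⁻¹ : ℂ))
  rw [← fderiv_fderiv_apply hf, ← fderiv_fderiv_apply hf]
  simp only [wDbar, div_eq_mul_inv]
  rw [HasFDerivAt.fderiv h]
  simp [mul_comm, mul_add]

theorem fderiv_wD (hf : ContDiffAt ℝ 2 f x) (v w : E) :
    fderiv ℝ (fun t => wD f t w) x v =
      (fderiv ℝ (fderiv ℝ f) x v w - I * fderiv ℝ (fderiv ℝ f) x v (I • w)) / 2 := by
  have h := (((differentiableAt_fderiv_apply hf w).hasFDerivAt.fun_sub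
    ((differentiableAt_fderiv_apply hf (I • w)).hasFDerivAt.const_mul I)).mul_const (2⁻¹ : ℂ))
  rw [← fderiv_fderiv_apply hf, ← fderiv_fderiv_apply hf]
  simp only [wD, div_eq_mul_inv]
  rw [HasFDerivAt.fderiv h]
  simp [mul_comm]

theorem wD_wDbar_comm (hf : ContDiffAt ℝ 2 f x) (v w : E) :
    wD (fun t => wDbar f t w) x v = wDbar (fun t => wD f t v) x w := by
  have hsymm := hf.isSymmSndFDerivAt (by simp)
  rw [wD, wDbar, fderiv_wDbar hf, fderiv_wDbar hf, fderiv_wD hf, fderiv_wD hf,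
    hsymm.eq w v, hsymm.eq w (I • v), hsymm.eq (I • w) v, hsymm.eq (I • w) (I • v)]
  ring

end Wirtinger

theorem differentiableAt_wD_of_differentiableOn {m : ℕ} {U : Set (Fin m → ℂ)} (hU : IsOpen U)
    {g : (Fin m → ℂ) → ℂ} (hg : DifferentiableOn ℂ g U) {x : Fin m → ℂ} (hx : x ∈ U)
    (w : Fin m → ℂ) : DifferentiableAt ℂ (fun t => wD g t w) x := by
  refine (differentiableAt_fderiv_apply_of_differentiableOn hU hg hx w).congr_of_eventuallyEq ?_
  filter_upwards [hU.mem_nhds hx] with t ht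
  exact wD_eq_fderiv (hg.differentiableAt (hU.mem_nhds ht)) w

theorem wDbar_mul_holomorphic_mul_conj {E : Type*} [NormedAddCommGroup E] [NormedSpace ℂ E]
    {H f g : E → ℂ} {x : E} (hH : DifferentiableAt ℝ H x) (hf : DifferentiableAt ℂ f x)
    (hg : DifferentiableAt ℂ g x) (w : E) :
    wDbar (fun s => H s * f s * (starRingEnd ℂ) (g s)) x w =
      wDbar H x w * f x * (starRingEnd ℂ) (g x) + H x * f x * (starRingEnd ℂ) (wD g x w) := by
  have hf' := hf.restrictScalars ℝ
  have hg' := hg.restrictScalars ℝ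
  rw [wDbar_mul (hH.fun_mul hf') (differentiableAt_conj_comp hg'), wDbar_mul hH hf',
    wDbar_eq_zero hf, wDbar_conj hg']
  ring

theorem wD_mul_holomorphic_mul_conj {E : Type*} [NormedAddCommGroup E] [NormedSpace ℂ E]
    {H f g : E → ℂ} {x : E} (hH : DifferentiableAt ℝ H x) (hf : DifferentiableAt ℂ f x)
    (hg : DifferentiableAt ℂ g x) (w : E) :
    wD (fun s => H s * f s * (starRingEnd ℂ) (g s)) x w =
      (wD H x w * f x + H x * wD f x w) * (starRingEnd ℂ) (g x) := by
  have hf' := hf.restrictScalars ℝ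
  have hg' := hg.restrictScalars ℝ
  rw [wD_mul (hH.fun_mul hf') (differentiableAt_conj_comp hg'), wD_mul hH hf',
    wD_conj hg', wDbar_eq_zero hg]
  simp

theorem differentiableAt_mul_holomorphic_mul_conj {E : Type*} [NormedAddCommGroup E]
    [NormedSpace ℂ E] {H f g : E → ℂ} {x : E} (hH : DifferentiableAt ℝ H x)
    (hf : DifferentiableAt ℂ f x) (hg : DifferentiableAt ℂ g x) :
    DifferentiableAt ℝ (fun s => H s * f s * (starRingEnd ℂ) (g s)) x :=
  (hH.mul (hf.restrictScalars ℝ)).mul (differentiableAt_conj_comp (hg.restrictScalars ℝ))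

theorem sip_mulVec {N : ℕ} (A : Matrix (Fin N) (Fin N) ℂ) (x y : Fin N → ℂ) :
    sip (A *ᵥ x) y = ∑ a, ∑ b, A a b * x b * (starRingEnd ℂ) (y a) := by
  simp only [sip, mulVec, dotProduct, Finset.sum_mul]

theorem sip_add_left {N : ℕ} (x y z : Fin N → ℂ) : sip (x + y) z = sip x z + sip y z := by
  simp [sip, add_mul, Finset.sum_add_distrib]

theorem sip_neg_left {N : ℕ} (x z : Fin N → ℂ) : sip (-x) z = -sip x z := by
  simp [sip]

section Metric

variable {m N : ℕ} {U : Set (Fin m → ℂ)} {h : (Fin m → ℂ) → Matrix (Fin N) (Fin N) ℂ}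
  {t₀ : Fin m → ℂ}

/-- The mixed second derivative `∂_j∂̄_k⟪h·u, v⟫` for holomorphic `u` and `v`. -/
theorem wD_wDbar_sip (hU : IsOpen U) (hsm : ∀ a b, ContDiffOn ℝ 2 (fun t => h t a b) U)
    (ht₀ : t₀ ∈ U) {u v : (Fin m → ℂ) → (Fin N → ℂ)} (hu : DifferentiableOn ℂ u U)
    (hv : DifferentiableOn ℂ v U) (j k : Fin m) :
    wD (fun t => wDbar (fun s => sip (h s *ᵥ u s) (v s)) t (Pi.single k 1)) t₀ (Pi.single j 1) =
      sip (mD (fun s => mDbar h s k) t₀ j *ᵥ u t₀ + mDbar h t₀ k *ᵥ vD u t₀ j) (v t₀) +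
      sip (mD h t₀ j *ᵥ u t₀ + h t₀ *ᵥ vD u t₀ j) (vD v t₀ k) := by
  have hH : ∀ t ∈ U, ∀ a b, ContDiffAt ℝ 2 (fun s => h s a b) t := fun t ht a b =>
    (hsm a b).contDiffAt (hU.mem_nhds ht)
  have hH1 : ∀ t ∈ U, ∀ a b, DifferentiableAt ℝ (fun s => h s a b) t := fun t ht a b =>
    (hH t ht a b).differentiableAt two_ne_zero
  have hu' : ∀ t ∈ U, ∀ a, DifferentiableAt ℂ (fun s => u s a) t := fun t ht a =>
    differentiableAt_pi.1 (hu.differentiableAt (hU.mem_nhds ht)) a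
  have hv' : ∀ t ∈ U, ∀ a, DifferentiableAt ℂ (fun s => v s a) t := fun t ht a =>
    differentiableAt_pi.1 (hv.differentiableAt (hU.mem_nhds ht)) a
  have hvD : ∀ a, DifferentiableAt ℂ (fun s => wD (fun s => v s a) s (Pi.single k 1)) t₀ :=
    fun a => differentiableAt_wD_of_differentiableOn hU
      (fun t ht => (hv' t ht a).differentiableWithinAt) ht₀ _
  have hinner : (fun t => wDbar (fun s => sip (h s *ᵥ u s) (v s)) t (Pi.single k 1)) =ᶠ[nhds t₀]
      fun t => ∑ a, ∑ b,
        (wDbar (fun s => h s a b) t (Pi.single k 1) * u t b * (starRingEnd ℂ) (v t a) +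
          h t a b * u t b * (starRingEnd ℂ) (wD (fun s => v s a) t (Pi.single k 1))) := by
    filter_upwards [hU.mem_nhds ht₀] with t ht
    have hterm := fun a b =>
      differentiableAt_mul_holomorphic_mul_conj (hH1 t ht a b) (hu' t ht b) (hv' t ht a)
    simp only [sip_mulVec]
    rw [wDbar_sum _ fun a _ => DifferentiableAt.fun_sum fun b _ => hterm a b]
    refine Finset.sum_congr rfl fun a _ => ?_
    rw [wDbar_sum _ fun b _ => hterm a b]
    exact Finset.sum_congr rfl fun b _ =>
      wDbar_mul_holomorphic_mul_conj (hH1 t ht a b) (hu' t ht b) (hv' t ht a) _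
  have hd1 := fun a b => differentiableAt_mul_holomorphic_mul_conj
    (differentiableAt_wDbar (hH t₀ ht₀ a b) (Pi.single k 1)) (hu' t₀ ht₀ b) (hv' t₀ ht₀ a)
  have hd2 := fun a b => differentiableAt_mul_holomorphic_mul_conj
    (hH1 t₀ ht₀ a b) (hu' t₀ ht₀ b) (hvD a)
  rw [wD_congr hinner, wD_sum _ fun a _ => DifferentiableAt.fun_sum fun b _ =>
    (hd1 a b).fun_add (hd2 a b)]
  simp only [sip_add_left, sip_mulVec, ← Finset.sum_add_distrib]
  refine Finset.sum_congr rfl fun a _ => ?_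
  rw [wD_sum _ fun b _ => (hd1 a b).fun_add (hd2 a b)]
  refine Finset.sum_congr rfl fun b _ => ?_
  rw [wD_add (hd1 a b) (hd2 a b), wD_mul_holomorphic_mul_conj
    (differentiableAt_wDbar (hH t₀ ht₀ a b) (Pi.single k 1)) (hu' t₀ ht₀ b) (hv' t₀ ht₀ a),
    wD_mul_holomorphic_mul_conj (hH1 t₀ ht₀ a b) (hu' t₀ ht₀ b) (hvD a)]
  simp only [mD, mDbar, vD, Matrix.of_apply]
  ring

theorem differentiableAt_det {E ι : Type*} [NormedAddCommGroup E] [NormedSpace ℝ E] [Fintype ι]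
    [DecidableEq ι] {A : E → Matrix ι ι ℂ} {x : E}
    (hA : ∀ a b, DifferentiableAt ℝ (fun t => A t a b) x) :
    DifferentiableAt ℝ (fun t => (A t).det) x := by
  simp only [Matrix.det_apply']
  exact DifferentiableAt.fun_sum fun σ _ =>
    (HasFDerivAt.finsetProd fun i _ => (hA (σ i) i).hasFDerivAt).differentiableAt.const_mul _

theorem differentiableAt_inv_apply {E ι : Type*} [NormedAddCommGroup E] [NormedSpace ℝ E]
    [Fintype ι] [DecidableEq ι] {A : E → Matrix ι ι ℂ} {x : E}
    (hA : ∀ a b, DifferentiableAt ℝ (fun t => A t a b) x) (hx : (A x).det ≠ 0) (a b : ι) :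
    DifferentiableAt ℝ (fun t => (A t)⁻¹ a b) x := by
  simp only [Matrix.inv_def, Matrix.smul_apply, Matrix.adjugate_apply, Ring.inverse_eq_inv',
    smul_eq_mul]
  refine ((differentiableAt_det hA).inv hx).mul (differentiableAt_det fun i j => ?_)
  simp only [Matrix.updateRow_apply]
  split_ifs
  exacts [differentiableAt_const _, hA i j]

/-- The curvature in terms of the derivatives of the metric:
`h·Θ_{jk} = -∂_j∂̄_k h + (∂̄_k h)·h⁻¹·(∂_j h)`. -/
theorem mul_curv (hU : IsOpen U) (hsm : ∀ a b, ContDiffOn ℝ 2 (fun t => h t a b) U)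
    (hdet : ∀ t ∈ U, (h t).det ≠ 0) (ht₀ : t₀ ∈ U) (j k : Fin m) :
    h t₀ * curv h j k t₀ =
      -mD (fun s => mDbar h s k) t₀ j + mDbar h t₀ k * ((h t₀)⁻¹ * mD h t₀ j) := by
  have hH : ∀ a b, ContDiffAt ℝ 2 (fun s => h s a b) t₀ := fun a b =>
    (hsm a b).contDiffAt (hU.mem_nhds ht₀)
  have hH1 : ∀ a b, DifferentiableAt ℝ (fun s => h s a b) t₀ := fun a b =>
    (hH a b).differentiableAt two_ne_zero
  have hG : ∀ a b, DifferentiableAt ℝ (fun s => ((h s)⁻¹ * mD h s j) a b) t₀ := by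
    intro a b
    simp only [Matrix.mul_apply]
    exact DifferentiableAt.fun_sum fun c _ =>
      (differentiableAt_inv_apply hH1 (hdet t₀ ht₀) a c).mul
        (differentiableAt_wD (hH c b) (Pi.single j 1))
  have hprod : mD (fun s => mDbar h s k) t₀ j =
      mDbar h t₀ k * ((h t₀)⁻¹ * mD h t₀ j) +
        h t₀ * mDbar (fun s => (h s)⁻¹ * mD h s j) t₀ k := by
    ext a b
    have hcongr : (fun s => wD (fun s => h s a b) s (Pi.single j 1)) =ᶠ[nhds t₀]
        fun s => ∑ c, h s a c * ((h s)⁻¹ * mD h s j) c b := by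
      filter_upwards [hU.mem_nhds ht₀] with s hs
      rw [← Matrix.mul_apply, Matrix.mul_nonsing_inv_cancel_left _ _ (hdet s hs).isUnit]
      rfl
    calc mD (fun s => mDbar h s k) t₀ j a b
        = wD (fun s => wDbar (fun s => h s a b) s (Pi.single k 1)) t₀ (Pi.single j 1) := rfl
      _ = wDbar (fun s => wD (fun s => h s a b) s (Pi.single j 1)) t₀ (Pi.single k 1) :=
          wD_wDbar_comm (hH a b) _ _
      _ = ∑ c, wDbar (fun s => h s a c * ((h s)⁻¹ * mD h s j) c b) t₀ (Pi.single k 1) := by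
          rw [wDbar_congr hcongr, wDbar_sum _ fun c _ => (hH1 a c).fun_mul (hG c b)]
      _ = _ := by
          rw [Matrix.add_apply, Matrix.mul_apply, Matrix.mul_apply, ← Finset.sum_add_distrib]
          exact Finset.sum_congr rfl fun c _ => wDbar_mul (hH1 a c) (hG c b) _
  rw [hprod, curv, Matrix.mul_neg]
  abel

/-- For holomorphic sections `u` with `D_j u (t₀) = 0` and `v`, the mixed derivative
`∂_j∂̄_k⟪h·u, v⟫` at `t₀` is `-⟪h·Θ_{jk}·u, v⟫`. -/
theorem wD_wDbar_sip_of_chern_eq_zero (hU : IsOpen U)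
    (hsm : ∀ a b, ContDiffOn ℝ 2 (fun t => h t a b) U) (hdet : ∀ t ∈ U, (h t).det ≠ 0)
    (ht₀ : t₀ ∈ U) {u v : (Fin m → ℂ) → (Fin N → ℂ)} (hu : DifferentiableOn ℂ u U)
    (hv : DifferentiableOn ℂ v U) {j : Fin m} (hD : chern h u j t₀ = 0) (k : Fin m) :
    wD (fun t => wDbar (fun s => sip (h s *ᵥ u s) (v s)) t (Pi.single k 1)) t₀ (Pi.single j 1) =
      -sip (h t₀ *ᵥ (curv h j k t₀ *ᵥ u t₀)) (v t₀) := by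
  have hvD : vD u t₀ j = -(((h t₀)⁻¹ * mD h t₀ j) *ᵥ u t₀) := eq_neg_of_add_eq_zero_left hD
  rw [wD_wDbar_sip hU hsm ht₀ hu hv, hvD, Matrix.mulVec_mulVec, mul_curv hU hsm hdet ht₀,
    ← sip_neg_left]
  simp only [Matrix.mulVec_neg, Matrix.mulVec_mulVec,
    Matrix.mul_nonsing_inv_cancel_left _ _ (hdet t₀ ht₀).isUnit, Matrix.add_mulVec,
    Matrix.neg_mulVec]
  rw [add_neg_cancel, neg_add, neg_neg]
  simp [sip]

/-- Every vector extends to an affine section whose Chern derivatives vanish at `t₀`. -/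
theorem exists_differentiable_chern_eq_zero (h : (Fin m → ℂ) → Matrix (Fin N) (Fin N) ℂ)
    (t₀ : Fin m → ℂ) (a : Fin N → ℂ) :
    ∃ u : (Fin m → ℂ) → (Fin N → ℂ), Differentiable ℂ u ∧ u t₀ = a ∧
      ∀ j, chern h u j t₀ = 0 := by
  set B : Fin m → Fin N → ℂ := fun j => ((h t₀)⁻¹ * mD h t₀ j) *ᵥ a with hB
  have hu : ∀ t c, HasFDerivAt (fun t : Fin m → ℂ => a c - ∑ i, (t i - t₀ i) * B i c)
      (-∑ i, (B i c) • (ContinuousLinearMap.proj i : (Fin m → ℂ) →L[ℂ] ℂ)) t := by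
    intro t c
    refine (HasFDerivAt.fun_sum fun i _ => ?_).const_sub (a c)
    exact ((hasFDerivAt_apply i t).sub_const (t₀ i)).mul_const (B i c)
  refine ⟨fun t c => a c - ∑ i, (t i - t₀ i) * B i c,
    differentiable_pi.2 fun c t => (hu t c).differentiableAt, by simp, fun j => ?_⟩
  ext c
  have hv : vD (fun t c => a c - ∑ i, (t i - t₀ i) * B i c) t₀ j c = -B j c := by
    rw [vD, wD_eq_fderiv (hu t₀ c).differentiableAt, (hu t₀ c).fderiv]
    simp [Pi.single_apply]
  rw [chern, Pi.add_apply, hv]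
  simp [hB]

end Metric

/-- **The criterion (2.5) for Nakano semipositivity (Section 2).** The curvature of a
hermitian metric `h` on the trivial bundle `U×ℂ^N` is Nakano-semipositive at `t₀` iff for
every `m`-tuple of holomorphic sections `u_j` with `D_j u_k (t₀) = 0` the quantity
`Σ_{j,k} ∂_{t_j}∂̄_{t_k}⟪h·u_j, u_k⟫` at `t₀` is real and `≤ 0` (complex order). -/
theorem stmt7 {m N : ℕ}
    (U : Set (Fin m → ℂ)) (hU : IsOpen U)
    (h : (Fin m → ℂ) → Matrix (Fin N) (Fin N) ℂ)
    (hsm : ∀ a b, ContDiffOn ℝ (⊤ : ℕ∞) (fun t => h t a b) U)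
    (hpos : ∀ t ∈ U, (h t).PosDef)
    (t₀ : Fin m → ℂ) (ht₀ : t₀ ∈ U) :
    (∀ a : Fin m → (Fin N → ℂ),
      0 ≤ ∑ j, ∑ k, sip (h t₀ *ᵥ (curv h j k t₀ *ᵥ a j)) (a k)) ↔
    (∀ u : Fin m → ((Fin m → ℂ) → (Fin N → ℂ)),
      (∀ j, DifferentiableOn ℂ (u j) U) →
      (∀ j k, chern h (u k) j t₀ = 0) →
      (∑ j, ∑ k, wD (fun t =>
          wDbar (fun s => sip (h s *ᵥ u j s) (u k s)) t (Pi.single k 1))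
        t₀ (Pi.single j 1)) ≤ 0) := by
  have hsm' : ∀ a b, ContDiffOn ℝ 2 (fun t => h t a b) U := fun a b =>
    (hsm a b).of_le (WithTop.coe_le_coe.2 (le_top : (2 : ℕ∞) ≤ ⊤))
  have hdet : ∀ t ∈ U, (h t).det ≠ 0 := fun t ht => (hpos t ht).det_pos.ne'
  have key : ∀ u : Fin m → ((Fin m → ℂ) → (Fin N → ℂ)), (∀ j, DifferentiableOn ℂ (u j) U) →
      (∀ j k, chern h (u k) j t₀ = 0) →
      (∑ j, ∑ k, wD (fun t => wDbar (fun s => sip (h s *ᵥ u j s) (u k s)) t (Pi.single k 1))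
        t₀ (Pi.single j 1)) =
      -∑ j, ∑ k, sip (h t₀ *ᵥ (curv h j k t₀ *ᵥ u j t₀)) (u k t₀) := by
    intro u hu hD
    simp only [← Finset.sum_neg_distrib]
    exact Finset.sum_congr rfl fun j _ => Finset.sum_congr rfl fun k _ =>
      wD_wDbar_sip_of_chern_eq_zero hU hsm' hdet ht₀ (hu j) (hu k) (hD j j) k
  constructor
  · intro hnak u hu hD
    rw [key u hu hD, neg_nonpos]
    exact hnak fun j => u j t₀
  · intro hcrit a
    choose u hu hu₀ hD using fun j => exists_differentiable_chern_eq_zero h t₀ (a j)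
    have := hcrit u (fun j => (hu j).differentiableOn) fun j k => hD k j
    rw [key u (fun j => (hu j).differentiableOn) fun j k => hD k j, neg_nonpos] at this
    simpa only [hu₀] using this
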